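/- Let G be a quasiassociative quasigroup. Then the associator is natural with respect to the product on N(G) ⋉ G: for all l, m, n ∈ N(G) and g, h, k ∈ G, β(l·g, m·h, n·k) · ((l · Ad_g(m)) · Ad_{g·h}(n)) = (l · Ad_g(m · Ad_h(n))) · β(g, h, k). (All displayed factors lie in the nucleus N(G), so the bracketing of these products is immaterial.) -/

import Mathlib

/-- A quasigroup (in the sense of the paper): a type with a multiplication,
a two-sided identity, and an inverse operation satisfying
`g⁻¹ * (g * h) = h` and `(h * g⁻¹) * g = h`. -/
class PaperQuasigroup (G : Type*) extends Mul G, One G, Inv G where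
  one_mul : ∀ g : G, 1 * g = g
  mul_one : ∀ g : G, g * 1 = g
  inv_mul_cancel_left : ∀ g h : G, g⁻¹ * (g * h) = h
  mul_inv_cancel_right : ∀ g h : G, (h * g⁻¹) * g = h

/-- The nucleus `N(G)` of associative elements of a quasigroup. -/
def PaperQuasigroup.nucleus (G : Type*) [PaperQuasigroup G] : Set G :=
  {a | ∀ g h : G,
    (a * g) * h = a * (g * h) ∧ (g * a) * h = g * (a * h) ∧ (g * h) * a = g * (h * a)}

/-- The multiplicative associator `β(g,h,k) = (g·(h·k))·((g·h)·k)⁻¹`. -/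
def PaperQuasigroup.associator {G : Type*} [PaperQuasigroup G] (g h k : G) : G :=
  (g * (h * k)) * ((g * h) * k)⁻¹

/-- A quasigroup is quasiassociative if the associator takes values in the nucleus
and the nucleus is stable under conjugation. -/
def PaperQuasigroup.IsQuasiassociative (G : Type*) [PaperQuasigroup G] : Prop :=
  (∀ g h k : G, PaperQuasigroup.associator g h k ∈ PaperQuasigroup.nucleus G) ∧
  (∀ g a : G, a ∈ PaperQuasigroup.nucleus G → (g * a) * g⁻¹ ∈ PaperQuasigroup.nucleus G)


/-- The adjoint action `Ad_g(a) := (g·a)·g⁻¹`. -/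
def PaperQuasigroup.Ad {G : Type*} [PaperQuasigroup G] (g a : G) : G := (g * a) * g⁻¹

namespace PaperQuasigroup

variable {G : Type*} [PaperQuasigroup G]

theorem inv_inv_eq (g : G) : g⁻¹⁻¹ = g := by
  have h := PaperQuasigroup.inv_mul_cancel_left g⁻¹ (g * 1)
  rwa [PaperQuasigroup.inv_mul_cancel_left g 1, PaperQuasigroup.mul_one,
    PaperQuasigroup.mul_one] at h

theorem mul_mul_inv_cancel (h g : G) : (h * g) * g⁻¹ = h := by
  have e := PaperQuasigroup.mul_inv_cancel_right g⁻¹ h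
  rwa [inv_inv_eq] at e

theorem eq_of_mul_eq_mul_right {g x y : G} (e : x * g = y * g) : x = y := by
  rw [← mul_mul_inv_cancel x g, e, mul_mul_inv_cancel]

theorem Ad_mul_self (g a : G) : Ad g a * g = g * a :=
  PaperQuasigroup.mul_inv_cancel_right g (g * a)

theorem associator_mul (g h k : G) : associator g h k * ((g * h) * k) = g * (h * k) :=
  PaperQuasigroup.mul_inv_cancel_right _ _

section nucleus

variable {a b : G}

theorem nucleus_left (ha : a ∈ nucleus G) (g h : G) : (a * g) * h = a * (g * h) :=
  (ha g h).1

theorem nucleus_middle (ha : a ∈ nucleus G) (g h : G) : (g * a) * h = g * (a * h) :=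
  (ha g h).2.1

theorem nucleus_right (ha : a ∈ nucleus G) (g h : G) : (g * h) * a = g * (h * a) :=
  (ha g h).2.2

theorem mul_mem_nucleus (ha : a ∈ nucleus G) (hb : b ∈ nucleus G) : a * b ∈ nucleus G := by
  intro g h
  refine ⟨?_, ?_, ?_⟩
  · simp only [nucleus_left ha, nucleus_left hb]
  · rw [← nucleus_right hb, nucleus_middle hb, nucleus_middle ha, nucleus_left ha]
  · rw [← nucleus_right hb, nucleus_right ha, nucleus_right hb, nucleus_right hb]

/-- Moving a nuclear element past the left factor of a product. -/
theorem Ad_mul_mul {g : G} (ha : a ∈ nucleus G) (hAd : Ad g a ∈ nucleus G) (x : G) :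
    Ad g a * (g * x) = g * (a * x) := by
  rw [← nucleus_left hAd, Ad_mul_self, nucleus_middle ha]

end nucleus

end PaperQuasigroup

open PaperQuasigroup in
/-- Naturality of the associator with respect to the product on `N(G) ⋉ G`:
`β(l·g, m·h, n·k) · ((l·Ad_g(m))·Ad_{g·h}(n)) = (l·Ad_g(m·Ad_h(n))) · β(g,h,k)`. -/
theorem quasiassociative_associator_natural {G : Type*} [PaperQuasigroup G]
    (hG : IsQuasiassociative G) (l m n g h k : G)
    (hl : l ∈ nucleus G) (hm : m ∈ nucleus G) (hn : n ∈ nucleus G) :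
    associator (l * g) (m * h) (n * k) * ((l * Ad g m) * Ad (g * h) n)
      = (l * Ad g (m * Ad h n)) * associator g h k := by
  have hAd : ∀ {x a : G}, a ∈ nucleus G → Ad x a ∈ nucleus G := fun ha => hG.2 _ _ ha
  have hp : m * Ad h n ∈ nucleus G := mul_mem_nucleus hm (hAd hn)
  have hleft : ((l * Ad g m) * Ad (g * h) n) * ((g * h) * k)
      = ((l * g) * (m * h)) * (n * k) := by
    rw [nucleus_middle (hAd hn), Ad_mul_mul hn (hAd hn), nucleus_left hl,
      ← nucleus_left (hAd hm), Ad_mul_mul hm (hAd hm), ← nucleus_left hl, ← nucleus_left hl]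
  have hright : (l * Ad g (m * Ad h n)) * (g * (h * k))
      = (l * g) * ((m * h) * (n * k)) := by
    rw [nucleus_left hl, Ad_mul_mul hp (hAd hp), nucleus_left hm,
      Ad_mul_mul hn (hAd hn), nucleus_left hl, nucleus_left hm]
  apply eq_of_mul_eq_mul_right (g := (g * h) * k)
  rw [nucleus_left (hG.1 _ _ _), hleft, associator_mul, nucleus_middle (hG.1 _ _ _),
    associator_mul, hright]
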